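/- arXiv:1105.4891 — 9 statements merged into one kernel-verified Lean document; each statement's English description precedes it below -/
import Mathlib

section
/- For all natural numbers m, n with 1 ≤ n ≤ m, the following identity of rational numbers holds: (m!/n!) · Σ 1/(i_1 · i_2 ⋯ i_n) = Σ t_1 · t_2 ⋯ t_{m−n}, where the left-hand sum is over all n-tuples (i_1, …, i_n) of positive integers with i_1 + ⋯ + i_n = m, and the right-hand sum is over all strictly increasing (m−n)-tuples of integers 0 ≤ t_1 < t_2 < ⋯ < t_{m−n} < m (an empty product being 1). -/
open PowerSeries in
/-- The coefficients of a power of a power series, as a sum over tuples of exponents. -/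
theorem PowerSeries.coeff_pow_eq_sum_antidiagonalTuple {R : Type*} [CommSemiring R]
    (f : PowerSeries R) (n m : ℕ) :
    coeff m (f ^ n) = ∑ a ∈ Finset.Nat.antidiagonalTuple n m, ∏ i, coeff (a i) f := by
  have h := coeff_prod (fun _ : Fin n => f) m Finset.univ
  rw [Finset.prod_const, Finset.card_univ, Fintype.card_fin] at h
  rw [h]
  refine Finset.sum_nbij' (fun l => ⇑l) (fun a => Finsupp.equivFunOnFinite.symm a) ?_ ?_ ?_ ?_ ?_
  · intro l hl
    simpa [Finset.mem_finsuppAntidiag, Finset.Nat.mem_antidiagonalTuple] using hl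
  · intro a ha
    simpa [Finset.mem_finsuppAntidiag, Finset.Nat.mem_antidiagonalTuple] using ha
  · intro l _
    ext i
    simp
  · intro a _
    simp
  · intro l _
    rfl

/-- The power series `∑ k ≥ 1, X ^ k / k` of `-log (1 - X)`. -/
noncomputable def negLogOneSub : PowerSeries ℚ :=
  PowerSeries.mk fun k => 1 / (k : ℚ)

open PowerSeries in
theorem one_sub_X_mul_derivative_negLogOneSub :
    (1 - X) * derivative ℚ negLogOneSub = 1 := by
  have h : derivative ℚ negLogOneSub = PowerSeries.mk 1 := by
    ext k
    have hk : (k : ℚ) + 1 ≠ 0 := by positivity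
    simp [negLogOneSub, coeff_derivative, hk]
  rw [h, mul_comm, PowerSeries.mk_one_mul_one_sub_eq_one]

open PowerSeries in
theorem coeff_negLogOneSub_pow_succ (n m : ℕ) :
    ((m : ℚ) + 1) * coeff (m + 1) (negLogOneSub ^ (n + 1)) =
      m * coeff m (negLogOneSub ^ (n + 1)) + (n + 1) * coeff m (negLogOneSub ^ n) := by
  have h : (1 - X) * derivative ℚ (negLogOneSub ^ (n + 1)) =
      C ((n : ℚ) + 1) * negLogOneSub ^ n := by
    rw [Derivation.leibniz_pow]
    simp only [nsmul_eq_mul, smul_eq_mul, Nat.add_sub_cancel]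
    have := one_sub_X_mul_derivative_negLogOneSub
    have hC : (C ((n : ℚ) + 1) : PowerSeries ℚ) = ((n + 1 : ℕ) : PowerSeries ℚ) := by simp
    rw [hC]
    linear_combination ((n + 1 : ℕ) : PowerSeries ℚ) * negLogOneSub ^ n * this
  have hm := congrArg (coeff m) h
  rw [coeff_C_mul, sub_mul, one_mul, map_sub, coeff_derivative] at hm
  cases m with
  | zero =>
    rw [coeff_zero_X_mul] at hm
    push_cast at hm ⊢
    linear_combination hm
  | succ k =>
    rw [coeff_succ_X_mul, coeff_derivative] at hm
    push_cast at hm ⊢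
    linear_combination hm

open PowerSeries in
theorem factorial_mul_coeff_negLogOneSub_pow (m n : ℕ) :
    (m.factorial : ℚ) * coeff m (negLogOneSub ^ n) = n.factorial * Nat.stirlingFirst m n := by
  induction m generalizing n with
  | zero => cases n <;> simp [negLogOneSub]
  | succ m ih =>
    cases n with
    | zero => simp [coeff_one]
    | succ n =>
      have h := coeff_negLogOneSub_pow_succ n m
      have h₁ := ih n
      have h₂ := ih (n + 1)
      rw [Nat.stirlingFirst_succ_succ]
      simp only [Nat.factorial_succ] at h₂ ⊢
      push_cast at h₂ ⊢
      linear_combination (m.factorial : ℚ) * h + m * h₂ + (n + 1) * h₁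

theorem sum_powersetCard_range_prod_eq_stirlingFirst {m n : ℕ} (h : n ≤ m) :
    ∑ T ∈ (Finset.range m).powersetCard (m - n), ∏ t ∈ T, t = Nat.stirlingFirst m n := by
  induction m generalizing n with
  | zero =>
    obtain rfl : n = 0 := by omega
    simp
  | succ m ih =>
    cases n with
    | zero =>
      have hs := Finset.powersetCard_self (Finset.range (m + 1))
      rw [Finset.card_range] at hs
      rw [Nat.sub_zero, hs, Finset.sum_singleton, Nat.stirlingFirst_succ_zero]
      exact Finset.prod_eq_zero (i := 0) (by simp) rfl
    | succ n =>
      rcases (Nat.le_of_succ_le_succ h).eq_or_lt with rfl | hlt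
      · simp [Nat.stirlingFirst_self]
      · obtain ⟨k, hk⟩ : ∃ k, m = n + 1 + k := ⟨m - (n + 1), by omega⟩
        have h₁ := ih (n := n) (by omega)
        have h₂ := ih (n := n + 1) (by omega)
        rw [show m - n = k + 1 by omega] at h₁
        rw [show m - (n + 1) = k by omega] at h₂
        have hm : ∀ T ∈ (Finset.range m).powersetCard k, m ∉ T := fun T hT hmT =>
          Finset.notMem_range_self ((Finset.mem_powersetCard.1 hT).1 hmT)
        rw [show m + 1 - (n + 1) = k + 1 by omega, Finset.range_add_one,
          Finset.powersetCard_succ_insert Finset.notMem_range_self, Finset.sum_union,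
          Finset.sum_image, h₁, Nat.stirlingFirst_succ_succ, ← h₂, Finset.mul_sum, add_comm]
        · congr 1
          exact Finset.sum_congr rfl fun T hT => Finset.prod_insert (hm T hT)
        · intro S hS T hT hST
          rw [← Finset.erase_insert (hm S hS), ← Finset.erase_insert (hm T hT), hST]
        · rw [Finset.disjoint_left]
          intro T hT hT'
          obtain ⟨S, -, rfl⟩ := Finset.mem_image.1 hT'
          exact Finset.notMem_range_self
            ((Finset.mem_powersetCard.1 hT).1 (Finset.mem_insert_self m S))

/-- The two classical explicit formulas for the signless Stirling numbers of the
first kind agree: `(m!/n!) · Σ 1/(i₁⋯iₙ) = Σ t₁⋯t_{m−n}`, where the left sum is over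
compositions of `m` into `n` positive parts and the right sum is over strictly
increasing `(m−n)`-tuples `0 ≤ t₁ < ⋯ < t_{m−n} < m` (encoded as subsets of
`{0, …, m−1}` of cardinality `m − n`). -/
theorem stirling_first_two_formulas (m n : ℕ) (h1 : 1 ≤ n) (h2 : n ≤ m) :
    (m.factorial : ℚ) / (n.factorial : ℚ) *
      ∑ f ∈ (Finset.Nat.antidiagonalTuple n m).filter (fun f => ∀ i, 0 < f i),
        ∏ i, (1 / (f i : ℚ)) =
    ∑ T ∈ (Finset.range m).powersetCard (m - n), ∏ t ∈ T, (t : ℚ) := by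
  have hL : ∑ f ∈ (Finset.Nat.antidiagonalTuple n m).filter (fun f => ∀ i, 0 < f i),
      ∏ i, (1 / (f i : ℚ)) = PowerSeries.coeff m (negLogOneSub ^ n) := by
    rw [PowerSeries.coeff_pow_eq_sum_antidiagonalTuple]
    simp only [negLogOneSub, PowerSeries.coeff_mk]
    refine Finset.sum_filter_of_ne fun f _ hf i => Nat.pos_of_ne_zero fun hi => hf ?_
    exact Finset.prod_eq_zero (Finset.mem_univ i) (by simp [hi])
  have hR := congrArg (Nat.cast : ℕ → ℚ) (sum_powersetCard_range_prod_eq_stirlingFirst h2)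
  push_cast at hR
  have hn : (n.factorial : ℚ) ≠ 0 := by positivity
  rw [hL, hR, div_mul_eq_mul_div, factorial_mul_coeff_negLogOneSub_pow,
    mul_div_cancel_left₀ _ hn]
end

section
/- For all natural numbers m, n with 1 ≤ n ≤ m, the following identity of rational numbers holds: (m!/n!) · Σ 1/(i_1! · i_2! ⋯ i_n!) = Σ i_1 · i_2 ⋯ i_{m−n}, where the left-hand sum is over all n-tuples (i_1, …, i_n) of positive integers with i_1 + ⋯ + i_n = m, and the right-hand sum is over all weakly increasing (m−n)-tuples of integers 0 ≤ i_1 ≤ i_2 ≤ ⋯ ≤ i_{m−n} ≤ n (an empty product being 1). -/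
open Finset PowerSeries in
theorem coeff_exp_sub_one_pow_eq_sum (m n : ℕ) :
    coeff m ((exp ℚ - 1) ^ n) =
      ∑ f ∈ (Finset.Nat.antidiagonalTuple n m).filter (fun f => ∀ i, 0 < f i),
        ∏ i, (1 / ((f i).factorial : ℚ)) := by
  have hcoeff (k : ℕ) : coeff k (exp ℚ - 1) = if 0 < k then 1 / (k.factorial : ℚ) else 0 := by
    rcases k.eq_zero_or_pos with rfl | hk
    · simp
    · simp [hk, coeff_one, hk.ne']
  have hpow : (exp ℚ - 1) ^ n = ∏ _i : Fin n, (exp ℚ - 1) := by simp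
  rw [hpow, coeff_prod, sum_filter]
  refine sum_bij (fun l _ => ⇑l) (fun l hl => ?_) (fun _ _ _ _ h => DFunLike.coe_injective h)
    (fun f hf => ⟨Finsupp.equivFunOnFinite.symm f, ?_, rfl⟩) (fun l _ => ?_)
  · simpa [Finset.Nat.mem_antidiagonalTuple] using hl
  · simpa [Finset.Nat.mem_antidiagonalTuple] using hf
  · simp only [hcoeff]
    split_ifs with h
    · exact prod_congr rfl fun i _ => if_pos (h i)
    · push Not at h
      obtain ⟨i, hi⟩ := h
      exact prod_eq_zero (mem_univ i) (if_neg hi.not_gt)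

open PowerSeries in
theorem factorial_mul_coeff_exp_sub_one_pow (m n : ℕ) :
    (m.factorial : ℚ) * coeff m ((exp ℚ - 1) ^ n) =
      n.factorial * Nat.stirlingSecond m n := by
  induction m generalizing n with
  | zero => cases n <;> simp
  | succ m ih =>
    cases n with
    | zero => simp [coeff_one]
    | succ n =>
      have hderiv : derivative ℚ ((exp ℚ - 1) ^ (n + 1)) =
          ((n + 1 : ℕ) : ℚ) • ((exp ℚ - 1) ^ (n + 1) + (exp ℚ - 1) ^ n) := by
        rw [derivative_pow, map_sub, derivative_exp, derivative_one, smul_eq_C_mul, map_natCast]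
        simp only [Nat.add_sub_cancel]
        ring
      have hcoeff := congrArg (coeff m) hderiv
      rw [coeff_derivative, coeff_smul, map_add, smul_eq_mul] at hcoeff
      have h₁ := ih (n + 1)
      have h₂ := ih n
      rw [Nat.stirlingSecond_succ_succ]
      simp only [Nat.factorial_succ] at h₁ ⊢
      push_cast at hcoeff h₁ ⊢
      linear_combination (m.factorial : ℚ) * hcoeff + (n + 1 : ℚ) * h₁ + (n + 1 : ℚ) * h₂

open Finset in
theorem sum_monotone_prod_succ_succ (k n : ℕ) :
    ∑ g ∈ univ.filter (fun g : Fin (k + 1) → Fin (n + 2) => ∀ i j, i ≤ j → g i ≤ g j),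
        ∏ i, (g i : ℕ) =
      (n + 1) * ∑ g ∈ univ.filter (fun g : Fin k → Fin (n + 2) => ∀ i j, i ≤ j → g i ≤ g j),
        ∏ i, (g i : ℕ) +
      ∑ g ∈ univ.filter (fun g : Fin (k + 1) → Fin (n + 1) => ∀ i j, i ≤ j → g i ≤ g j),
        ∏ i, (g i : ℕ) := by
  rw [← sum_filter_add_sum_filter_not _
    (fun g : Fin (k + 1) → Fin (n + 2) => g (Fin.last k) = Fin.last (n + 1)), mul_sum]
  congr 1
  · symm
    refine sum_bij (fun g _ => Fin.snoc (α := fun _ => Fin (n + 2)) g (Fin.last (n + 1)))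
      (fun g hg => ?_) (fun g _ g' _ h => ?_) (fun g hg => ⟨Fin.init g, ?_, ?_⟩) (fun g _ => ?_)
    · simp only [mem_filter, mem_univ, true_and, Fin.snoc_last, and_true] at hg ⊢
      intro i j hij
      induction j using Fin.lastCases with
      | last => simpa using Fin.le_last _
      | cast j =>
        induction i using Fin.lastCases with
        | last => exact absurd hij (Fin.castSucc_lt_last j).not_ge
        | cast i => simpa using hg i j (by simpa using hij)
    · simpa using congrArg (Fin.init (α := fun _ => Fin (n + 2))) h
    · simp only [mem_filter, mem_univ, true_and] at hg ⊢
      exact fun i j hij => hg.1 _ _ (by simpa using hij)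
    · simp only [mem_filter] at hg
      rw [← hg.2, Fin.snoc_init_self]
    · simp [Fin.prod_univ_castSucc, mul_comm]
  · symm
    refine sum_bij (fun g _ i => (g i).castSucc) (fun g hg => ?_) (fun g _ g' _ h => ?_)
      (fun g hg => ?_) (fun g _ => by simp)
    · simp only [mem_filter, mem_univ, true_and] at hg ⊢
      exact ⟨fun i j hij => by simpa using hg i j hij, (Fin.castSucc_lt_last _).ne⟩
    · exact funext fun i => Fin.castSucc_injective _ (congrFun h i)
    · simp only [mem_filter, mem_univ, true_and] at hg
      have hne (i) : g i ≠ Fin.last (n + 1) :=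
        ((hg.1 i _ (Fin.le_last i)).trans_lt (Fin.lt_last_iff_ne_last.mpr hg.2)).ne
      refine ⟨fun i => (g i).castPred (hne i), ?_, by simp⟩
      simp only [mem_filter, mem_univ, true_and]
      exact fun i j hij => by simpa using hg.1 i j hij

open Finset in
theorem stirlingSecond_add_eq_sum_monotone (k n : ℕ) :
    Nat.stirlingSecond (n + k) n =
      ∑ g ∈ univ.filter (fun g : Fin k → Fin (n + 1) => ∀ i j, i ≤ j → g i ≤ g j),
        ∏ i, (g i : ℕ) := by
  induction k generalizing n with
  | zero => simp [Nat.stirlingSecond_self]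
  | succ k ihk =>
    induction n with
    | zero => simp
    | succ n ihn =>
      rw [sum_monotone_prod_succ_succ, ← ihk (n + 1), ← ihn, ← add_assoc (n + 1) k 1,
        Nat.stirlingSecond_succ_succ, Nat.add_right_comm n 1 k, add_assoc n k 1]


/-- The two classical explicit formulas for the Stirling numbers of the second kind
agree: `(m!/n!) · Σ 1/(i₁!⋯iₙ!) = Σ i₁⋯i_{m−n}`, where the left sum is over
compositions of `m` into `n` positive parts and the right sum is over weakly
increasing `(m−n)`-tuples `0 ≤ i₁ ≤ ⋯ ≤ i_{m−n} ≤ n` (encoded as monotone functions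
`Fin (m−n) → Fin (n+1)`). -/
theorem stirling_second_two_formulas (m n : ℕ) (h1 : 1 ≤ n) (h2 : n ≤ m) :
    (m.factorial : ℚ) / (n.factorial : ℚ) *
      ∑ f ∈ (Finset.Nat.antidiagonalTuple n m).filter (fun f => ∀ i, 0 < f i),
        ∏ i, (1 / ((f i).factorial : ℚ)) =
    ∑ g ∈ Finset.univ.filter
        (fun g : Fin (m - n) → Fin (n + 1) => ∀ i j, i ≤ j → g i ≤ g j),
      ∏ i, ((g i : ℕ) : ℚ) := by
  obtain ⟨k, rfl⟩ := Nat.exists_eq_add_of_le h2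
  rw [Nat.add_sub_cancel_left, ← coeff_exp_sub_one_pow_eq_sum, div_mul_eq_mul_div,
    factorial_mul_coeff_exp_sub_one_pow,
    mul_div_cancel_left₀ _ (Nat.cast_ne_zero.mpr n.factorial_ne_zero),
    stirlingSecond_add_eq_sum_monotone]
  push_cast
  rfl
end

section
/- Let r, s be real numbers, let x > 1 be real, and let m ≥ 0. Then the m-th derivative at x of the function t ↦ t^s · (log t)^r (real powers) equals Σ_{j=0}^{m} (∏_{i=0}^{j−1}(r−i)) · (Σ_{0 ≤ t_1 < t_2 < ⋯ < t_{m−j} < m} (s−t_1)(s−t_2)⋯(s−t_{m−j})) · x^{s−m} · (log x)^{r−j}, where the inner sum is over all strictly increasing (m−j)-tuples of integers in {0,…,m−1} (an empty product being 1). -/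
/-- Pascal-type recursion for the elementary symmetric functions of `f 0, …, f (m - 1)`. -/
theorem sum_powersetCard_range_succ {R : Type*} [CommSemiring R] (f : ℕ → R) (m k : ℕ) :
    ∑ T ∈ (Finset.range (m + 1)).powersetCard (k + 1), ∏ t ∈ T, f t =
      ∑ T ∈ (Finset.range m).powersetCard (k + 1), ∏ t ∈ T, f t +
        f m * ∑ T ∈ (Finset.range m).powersetCard k, ∏ t ∈ T, f t := by
  have hm {n : ℕ} (T) (hT : T ∈ (Finset.range m).powersetCard n) : m ∉ T := fun h =>
    Finset.notMem_range_self ((Finset.mem_powersetCard.1 hT).1 h)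
  rw [Finset.range_add_one, Finset.powersetCard_succ_insert Finset.notMem_range_self,
    Finset.sum_union, Finset.sum_image, Finset.mul_sum]
  · congr 1
    exact Finset.sum_congr rfl fun T hT => Finset.prod_insert (hm T hT)
  · intro T hT U hU h
    rw [← Finset.erase_insert (hm T hT), ← Finset.erase_insert (hm U hU), h]
  · rw [Finset.disjoint_left]
    intro T hT hT'
    obtain ⟨U, -, rfl⟩ := Finset.mem_image.1 hT'
    exact hm _ hT (Finset.mem_insert_self _ _)

theorem hasDerivAt_rpow_mul_log_rpow (a b : ℝ) {x : ℝ} (hx : 1 < x) :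
    HasDerivAt (fun t : ℝ => t ^ a * Real.log t ^ b)
      (a * (x ^ (a - 1) * Real.log x ^ b) + b * (x ^ (a - 1) * Real.log x ^ (b - 1))) x := by
  have hx0 : 0 < x := one_pos.trans hx
  have hlog := (Real.hasDerivAt_log hx0.ne').rpow_const (p := b) (.inl (Real.log_pos hx).ne')
  refine ((Real.hasDerivAt_rpow_const (.inl hx0.ne')).mul hlog).congr_deriv ?_
  rw [Real.rpow_sub_one hx0.ne']
  ring

/-- The `m`-th derivative of `t ↦ t^s (log t)^r` (real powers) at `x > 1`:
`(d/dx)^m (x^s (log x)^r) = Σ_{j=0}^{m} r(r−1)⋯(r−j+1) ·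
(Σ_{0 ≤ t₁ < ⋯ < t_{m−j} < m} (s−t₁)⋯(s−t_{m−j})) · x^{s−m} (log x)^{r−j}`,
the inner sum being encoded as a sum over subsets of `{0,…,m−1}` of size `m−j`. -/
theorem iteratedDeriv_rpow_mul_log_rpow (r s : ℝ) (x : ℝ) (hx : 1 < x) (m : ℕ) :
    iteratedDeriv m (fun t : ℝ => t ^ s * Real.log t ^ r) x =
      ∑ j ∈ Finset.range (m + 1),
        (∏ i ∈ Finset.range j, (r - i)) *
          (∑ T ∈ (Finset.range m).powersetCard (m - j), ∏ t ∈ T, (s - t)) *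
          x ^ (s - m) * Real.log x ^ (r - j) := by
  induction m generalizing x with
  | zero => simp
  | succ m ih =>
    have hev : iteratedDeriv m (fun t : ℝ => t ^ s * Real.log t ^ r) =ᶠ[nhds x] fun y =>
        ∑ j ∈ Finset.range (m + 1), (∏ i ∈ Finset.range j, (r - i)) *
          (∑ T ∈ (Finset.range m).powersetCard (m - j), ∏ t ∈ T, (s - t)) *
          (y ^ (s - m) * Real.log y ^ (r - j)) := by
      filter_upwards [eventually_gt_nhds hx] with y hy
      simp only [ih y hy, mul_assoc]
    have hderiv := HasDerivAt.fun_sum (u := Finset.range (m + 1)) fun j _ =>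
      (hasDerivAt_rpow_mul_log_rpow (s - m) (r - j) hx).const_mul
        ((∏ i ∈ Finset.range j, (r - i)) *
          (∑ T ∈ (Finset.range m).powersetCard (m - j), ∏ t ∈ T, (s - t)))
    rw [iteratedDeriv_succ, hev.deriv_eq, hderiv.deriv]
    have hexp : s - ((m + 1 : ℕ) : ℝ) = s - m - 1 := by push_cast; ring
    have hempty : (Finset.range m).powersetCard (m + 1) = ∅ :=
      Finset.powersetCard_eq_empty.2 (by simp)
    have hshift := Finset.sum_range_succ' (fun j : ℕ => (∏ i ∈ Finset.range j, (r - i)) *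
      (∑ T ∈ (Finset.range m).powersetCard (m + 1 - j), ∏ t ∈ T, (s - t)) *
      x ^ (s - m - 1) * Real.log x ^ (r - j)) (m + 1)
    rw [Finset.sum_range_succ] at hshift
    simp only [Nat.sub_zero, hempty, Finset.sum_empty, mul_zero, zero_mul, add_zero,
      Nat.add_sub_add_right, Nat.sub_self, Finset.powersetCard_zero] at hshift
    symm
    rw [Finset.sum_range_succ _ (m + 1), hexp, Nat.sub_self, Finset.powersetCard_zero]
    have hrec : ∀ j ∈ Finset.range (m + 1),
        ∑ T ∈ (Finset.range (m + 1)).powersetCard (m + 1 - j), ∏ t ∈ T, (s - t) =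
          ∑ T ∈ (Finset.range m).powersetCard (m + 1 - j), ∏ t ∈ T, (s - t) +
            (s - m) * ∑ T ∈ (Finset.range m).powersetCard (m - j), ∏ t ∈ T, (s - t) := by
      intro j hj
      rw [Nat.succ_sub (Finset.mem_range_succ_iff.1 hj)]
      exact sum_powersetCard_range_succ (fun t : ℕ => s - t) m (m - j)
    rw [Finset.sum_congr rfl fun j hj => by rw [hrec j hj]]
    simp only [mul_add, add_mul, Finset.sum_add_distrib]
    rw [add_right_comm, hshift, add_comm]
    congr 1
    · exact Finset.sum_congr rfl fun j _ => by ring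
    · refine Finset.sum_congr rfl fun j _ => ?_
      rw [Finset.prod_range_succ, Nat.cast_add_one, sub_add_eq_sub_sub]
      ring
end

section
/- Let r, s be real numbers, let x be real, and let m ≥ 0. Then the m-th derivative at x of the function t ↦ exp(s·t) · exp(r · exp t) equals Σ_{j=0}^{m} r^j · (Σ_{0 ≤ t_1 ≤ t_2 ≤ ⋯ ≤ t_{m−j} ≤ j} (s+t_1)(s+t_2)⋯(s+t_{m−j})) · exp((s+j)·x) · exp(r · exp x), where the inner sum is over all weakly increasing (m−j)-tuples of integers in {0,…,j} (an empty product being 1). -/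
/-- The complete homogeneous symmetric sum of degree `k` in the values `f 0, …, f (n - 1)`. -/
def completeHomogeneousSum {R : Type*} [CommSemiring R] (f : ℕ → R) (k n : ℕ) : R :=
  ∑ g ∈ Finset.univ.filter (fun g : Fin k → Fin n => ∀ i i', i ≤ i' → g i ≤ g i'),
    ∏ i, f (g i)

section completeHomogeneousSum

variable {R : Type*} [CommSemiring R] (f : ℕ → R)

@[simp]
theorem completeHomogeneousSum_zero_left (n : ℕ) : completeHomogeneousSum f 0 n = 1 := by
  simp [completeHomogeneousSum]

@[simp]
theorem completeHomogeneousSum_succ_zero (k : ℕ) : completeHomogeneousSum f (k + 1) 0 = 0 := by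
  simp [completeHomogeneousSum]

theorem sum_monotone_last_eq (k n : ℕ) :
    ∑ g ∈ (Finset.univ.filter (fun g : Fin (k + 1) → Fin (n + 1) =>
        ∀ i i', i ≤ i' → g i ≤ g i')).filter (fun g => g (Fin.last k) = Fin.last n),
      ∏ i, f (g i) = f n * completeHomogeneousSum f k (n + 1) := by
  rw [completeHomogeneousSum, Finset.mul_sum]
  refine Finset.sum_bij' (fun g _ => Fin.init g)
    (fun h _ => (Fin.snoc h (Fin.last n) : Fin (k + 1) → Fin (n + 1))) ?_ ?_ ?_ ?_ ?_
  · intro g hg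
    simp only [Finset.mem_filter, Finset.mem_univ, true_and] at hg ⊢
    exact fun i i' h => hg.1 _ _ (Fin.castSucc_le_castSucc_iff.2 h)
  · intro h hh
    simp only [Finset.mem_filter, Finset.mem_univ, true_and] at hh ⊢
    refine ⟨fun i i' hi => ?_, by simp⟩
    induction i' using Fin.lastCases with
    | last => simpa using Fin.le_last _
    | cast i' =>
      induction i using Fin.lastCases with
      | last => exact absurd hi (not_le.2 (Fin.castSucc_lt_last i'))
      | cast i => simpa using hh i i' (Fin.castSucc_le_castSucc_iff.1 hi)
  · intro g hg
    rw [← (Finset.mem_filter.1 hg).2, Fin.snoc_init_self]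
  · intro h _
    simp
  · intro g hg
    rw [Fin.prod_univ_castSucc, (Finset.mem_filter.1 hg).2, mul_comm]
    simp [Fin.init]

theorem sum_monotone_last_ne (k n : ℕ) :
    ∑ g ∈ (Finset.univ.filter (fun g : Fin (k + 1) → Fin (n + 1) =>
        ∀ i i', i ≤ i' → g i ≤ g i')).filter (fun g => ¬ g (Fin.last k) = Fin.last n),
      ∏ i, f (g i) = completeHomogeneousSum f (k + 1) n := by
  symm
  refine Finset.sum_nbij (fun h i => (h i).castSucc) ?_ ?_ ?_ ?_
  · intro h hh
    simp only [Finset.mem_filter, Finset.mem_univ, true_and] at hh ⊢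
    exact ⟨fun i i' hi => Fin.castSucc_le_castSucc_iff.2 (hh i i' hi),
      (Fin.castSucc_lt_last _).ne⟩
  · intro h _ h' _ e
    exact funext fun i => Fin.castSucc_injective n (congrFun e i)
  · intro g hg
    simp only [Finset.coe_filter, Finset.mem_filter, Finset.mem_univ, true_and,
      Set.mem_ofPred_eq] at hg
    have hlt (i) : g i ≠ Fin.last n := fun e =>
      hg.2 (le_antisymm (Fin.le_last _) (e ▸ hg.1 i _ (Fin.le_last i)))
    refine ⟨fun i => (g i).castPred (hlt i), ?_, by simp⟩
    simp only [Finset.coe_filter, Finset.mem_univ, true_and, Set.mem_ofPred_eq]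
    exact fun i i' hi => Fin.castPred_le_castPred_iff.2 (hg.1 i i' hi)
  · simp

theorem completeHomogeneousSum_succ_succ (k n : ℕ) :
    completeHomogeneousSum f (k + 1) (n + 1) =
      f n * completeHomogeneousSum f k (n + 1) + completeHomogeneousSum f (k + 1) n := by
  rw [← sum_monotone_last_eq, ← sum_monotone_last_ne f k n, Finset.sum_filter_add_sum_filter_not]
  rfl

end completeHomogeneousSum

theorem hasDerivAt_exp_mul_exp_exp (r a x : ℝ) :
    HasDerivAt (fun t : ℝ => Real.exp (a * t) * Real.exp (r * Real.exp t))
      (a * (Real.exp (a * x) * Real.exp (r * Real.exp x)) +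
        r * (Real.exp ((a + 1) * x) * Real.exp (r * Real.exp x))) x := by
  have h₁ : HasDerivAt (fun t : ℝ => Real.exp (a * t)) (Real.exp (a * x) * (a * 1)) x :=
    ((hasDerivAt_id x).const_mul a).exp
  have h₂ := ((Real.hasDerivAt_exp x).const_mul r).exp
  refine (h₁.mul h₂).congr_deriv ?_
  rw [add_mul, one_mul, Real.exp_add]
  ring

theorem iteratedDeriv_exp_mul_exp_exp_eq_sum (r s : ℝ) (m : ℕ) :
    iteratedDeriv m (fun t : ℝ => Real.exp (s * t) * Real.exp (r * Real.exp t)) = fun x =>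
      ∑ j ∈ Finset.range (m + 1),
        r ^ j * completeHomogeneousSum (fun i => s + (i : ℝ)) (m - j) (j + 1) *
          (Real.exp ((s + j) * x) * Real.exp (r * Real.exp x)) := by
  induction m with
  | zero => simp
  | succ m ih =>
    rw [iteratedDeriv_succ, ih]
    funext x
    rw [(HasDerivAt.fun_sum fun (j : ℕ) _ =>
      (hasDerivAt_exp_mul_exp_exp r (s + j) x).const_mul
        (r ^ j * completeHomogeneousSum (fun i => s + (i : ℝ)) (m - j) (j + 1))).deriv]
    set c : ℕ → ℕ → ℝ := completeHomogeneousSum fun i => s + (i : ℝ)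
    set F : ℕ → ℝ := fun j => Real.exp ((s + j) * x) * Real.exp (r * Real.exp x)
    have hc (k n : ℕ) : c (k + 1) (n + 1) = (s + n) * c k (n + 1) + c (k + 1) n :=
      completeHomogeneousSum_succ_succ _ k n
    have hlhs : ∀ j ∈ Finset.range (m + 1),
        r ^ j * c (m - j) (j + 1) * ((s + j) * (Real.exp ((s + j) * x) *
          Real.exp (r * Real.exp x)) + r * (Real.exp ((s + j + 1) * x) *
          Real.exp (r * Real.exp x))) =
        r ^ j * ((s + j) * c (m - j) (j + 1)) * F j +
          r ^ (j + 1) * c (m + 1 - (j + 1)) (j + 1) * F (j + 1) := by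
      intro j _
      simp only [F, Nat.add_sub_add_right, Nat.cast_add, Nat.cast_one, ← add_assoc]
      ring
    have hrhs : ∀ j ∈ Finset.range (m + 1),
        r ^ j * c (m + 1 - j) (j + 1) * F j =
        r ^ j * ((s + j) * c (m - j) (j + 1)) * F j + r ^ j * c (m + 1 - j) j * F j := by
      intro j hj
      rw [Nat.succ_sub (Finset.mem_range_succ_iff.1 hj), hc]
      ring
    rw [Finset.sum_congr rfl hlhs, Finset.sum_add_distrib, Finset.sum_range_succ _ (m + 1),
      Finset.sum_congr rfl hrhs, Finset.sum_add_distrib, add_assoc]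
    congr 1
    rw [← add_zero (Finset.sum _ _)]
    have h₀ : r ^ 0 * c (m + 1 - 0) 0 * F 0 = 0 := by simp [c]
    rw [← h₀, ← Finset.sum_range_succ' (fun j => r ^ j * c (m + 1 - j) j * F j),
      Finset.sum_range_succ]
    simp [c, F]


/-- The `m`-th derivative of `t ↦ e^{st} e^{r e^t}` at `x`:
`(d/dx)^m (e^{sx} e^{r e^x}) = Σ_{j=0}^{m} r^j ·
(Σ_{0 ≤ t₁ ≤ ⋯ ≤ t_{m−j} ≤ j} (s+t₁)⋯(s+t_{m−j})) · e^{(s+j)x} e^{r e^x}`,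
the inner sum being encoded as a sum over monotone functions `Fin (m−j) → Fin (j+1)`. -/
theorem iteratedDeriv_exp_mul_exp_exp (r s : ℝ) (x : ℝ) (m : ℕ) :
    iteratedDeriv m (fun t : ℝ => Real.exp (s * t) * Real.exp (r * Real.exp t)) x =
      ∑ j ∈ Finset.range (m + 1),
        r ^ j *
          (∑ g ∈ Finset.univ.filter
              (fun g : Fin (m - j) → Fin (j + 1) => ∀ i i', i ≤ i' → g i ≤ g i'),
            ∏ i, (s + (g i : ℕ))) *
          Real.exp ((s + j) * x) * Real.exp (r * Real.exp x) := by
  rw [iteratedDeriv_exp_mul_exp_exp_eq_sum]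
  exact Finset.sum_congr rfl fun j _ => (mul_assoc _ _ _).symm
end

section
/- Let r be a real number, let x be real, and let m ≥ 0. Then the m-th derivative at x of the function t ↦ exp(r · exp t) equals Σ_{j=0}^{m} r^j · (Σ_{0 ≤ t_1 ≤ t_2 ≤ ⋯ ≤ t_{m−j} ≤ j} t_1 t_2 ⋯ t_{m−j}) · exp(j·x) · exp(r · exp x), where the inner sum is over all weakly increasing (m−j)-tuples of integers in {0,…,j} (an empty product being 1). -/
/-- The sum of the products `t₁ ⋯ t_d` over weakly increasing tuples `0 ≤ t₁ ≤ ⋯ ≤ t_d ≤ j`. -/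
noncomputable def monotoneProdSum (d j : ℕ) : ℝ :=
  ∑ g ∈ Finset.univ.filter (fun g : Fin d → Fin (j + 1) => ∀ i i', i ≤ i' → g i ≤ g i'),
    ∏ i, ((g i : ℕ) : ℝ)

theorem monotoneProdSum_zero_left (j : ℕ) : monotoneProdSum 0 j = 1 := by
  simp [monotoneProdSum]

theorem monotoneProdSum_succ_zero (d : ℕ) : monotoneProdSum (d + 1) 0 = 0 := by
  simp [monotoneProdSum]

theorem monotoneProdSum_succ_succ (d j : ℕ) :
    monotoneProdSum (d + 1) (j + 1) =
      (j + 1 : ℝ) * monotoneProdSum d (j + 1) + monotoneProdSum (d + 1) j := by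
  unfold monotoneProdSum
  rw [← Finset.sum_filter_add_sum_filter_not _
    (fun g : Fin (d + 1) → Fin (j + 2) => g (Fin.last d) = Fin.last (j + 1)), Finset.mul_sum]
  congr 1
  · refine Finset.sum_bij' (fun g _ => fun i : Fin d => g i.castSucc)
      (fun g _ => Fin.snoc (α := fun _ => Fin (j + 2)) g (Fin.last (j + 1))) ?_ ?_ ?_ ?_ ?_
    · intro g hg
      simp only [Finset.mem_filter, Finset.mem_univ, true_and] at hg ⊢
      exact fun i i' h => hg.1 _ _ (Fin.castSucc_le_castSucc_iff.2 h)
    · intro g hg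
      simp only [Finset.mem_filter, Finset.mem_univ, true_and, Fin.snoc_last, and_true] at hg ⊢
      intro i i' h
      induction i' using Fin.lastCases with
      | last => simpa using Fin.le_last _
      | cast i' =>
        induction i using Fin.lastCases with
        | last => exact absurd h (not_le_of_gt (Fin.castSucc_lt_last i'))
        | cast i => simpa using hg i i' (Fin.castSucc_le_castSucc_iff.1 h)
    · intro g hg
      simp only [Finset.mem_filter, Finset.mem_univ, true_and] at hg
      rw [← hg.2]
      exact Fin.snoc_init_self g
    · intro g _
      simp
    · intro g hg
      simp only [Finset.mem_filter, Finset.mem_univ, true_and] at hg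
      rw [Fin.prod_univ_castSucc, hg.2]
      simp [mul_comm]
  · symm
    refine Finset.sum_bij (fun g _ => fun i => (g i).castSucc) ?_ ?_ ?_ ?_
    · intro g hg
      simp only [Finset.mem_filter, Finset.mem_univ, true_and] at hg ⊢
      exact ⟨fun i i' h => Fin.castSucc_le_castSucc_iff.2 (hg i i' h),
        (Fin.castSucc_lt_last _).ne⟩
    · intro g _ g' _ h
      funext i
      exact Fin.castSucc_injective _ (congrFun h i)
    · intro g hg
      simp only [Finset.mem_filter, Finset.mem_univ, true_and] at hg
      have hne : ∀ i, g i ≠ Fin.last (j + 1) := fun i =>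
        ((hg.1 i _ (Fin.le_last i)).trans_lt (Fin.lt_last_iff_ne_last.2 hg.2)).ne_top
      refine ⟨fun i => (g i).castPred (hne i), ?_, ?_⟩
      · simp only [Finset.mem_filter, Finset.mem_univ, true_and]
        exact fun i i' h => Fin.castPred_le_castPred_iff.2 (hg.1 i i' h)
      · funext i
        simp
    · intro g _
      simp

theorem monotoneProdSum_eq_stirlingSecond (d j : ℕ) :
    monotoneProdSum d j = Nat.stirlingSecond (j + d) j := by
  induction d generalizing j with
  | zero => simp [monotoneProdSum_zero_left, Nat.stirlingSecond_self]
  | succ d ihd =>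
    induction j with
    | zero => simp [monotoneProdSum_succ_zero, Nat.stirlingSecond_succ_zero]
    | succ j ihj =>
      rw [monotoneProdSum_succ_succ, ihd, ihj, ← add_assoc (j + 1) d 1,
        Nat.stirlingSecond_succ_succ, show j + (d + 1) = j + 1 + d by ring]
      push_cast
      ring

theorem iteratedDeriv_exp_exp_stirlingSecond (r : ℝ) (m : ℕ) :
    iteratedDeriv m (fun t : ℝ => Real.exp (r * Real.exp t)) = fun x =>
      ∑ j ∈ Finset.range (m + 1),
        r ^ j * (Nat.stirlingSecond m j : ℝ) * Real.exp ((j : ℝ) * x) *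
          Real.exp (r * Real.exp x) := by
  induction m with
  | zero => simp
  | succ m ih =>
    rw [iteratedDeriv_succ, ih]
    funext x
    have hterm : ∀ j ∈ Finset.range (m + 1), HasDerivAt
        (fun x : ℝ => r ^ j * (Nat.stirlingSecond m j : ℝ) * Real.exp ((j : ℝ) * x) *
          Real.exp (r * Real.exp x))
        (r ^ j * ((j : ℝ) * Nat.stirlingSecond m j) * Real.exp ((j : ℝ) * x) *
            Real.exp (r * Real.exp x) +
          r ^ (j + 1) * (Nat.stirlingSecond m j : ℝ) * Real.exp (((j + 1 : ℕ) : ℝ) * x) *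
            Real.exp (r * Real.exp x)) x := by
      intro j _
      have h₁ := (((hasDerivAt_id x).const_mul (j : ℝ)).exp).const_mul
        (r ^ j * (Nat.stirlingSecond m j : ℝ))
      have h₂ := ((Real.hasDerivAt_exp x).const_mul r).exp
      refine (h₁.mul h₂).congr_deriv ?_
      rw [show ((j + 1 : ℕ) : ℝ) * x = (j : ℝ) * x + x by push_cast; ring, Real.exp_add]
      simp only [id]
      ring
    rw [(HasDerivAt.fun_sum hterm).deriv, Finset.sum_add_distrib, Finset.sum_range_succ' _ (m + 1)]
    have hshift := Finset.sum_range_succ' (fun j : ℕ =>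
      r ^ j * ((j : ℝ) * Nat.stirlingSecond m j) * Real.exp ((j : ℝ) * x) *
        Real.exp (r * Real.exp x)) (m + 1)
    rw [Finset.sum_range_succ, Nat.stirlingSecond_eq_zero_of_lt (Nat.lt_succ_self m)] at hshift
    simp only [Nat.cast_zero, mul_zero, zero_mul, add_zero] at hshift
    rw [hshift, ← Finset.sum_add_distrib, Nat.stirlingSecond_succ_zero]
    simp only [Nat.cast_zero, mul_zero, zero_mul, add_zero]
    refine Finset.sum_congr rfl fun j _ => ?_
    rw [Nat.stirlingSecond_succ_succ]
    push_cast
    ring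

/-- The `m`-th derivative of `t ↦ e^{r e^t}` at `x`:
`(d/dx)^m e^{r e^x} = Σ_{j=0}^{m} r^j ·
(Σ_{0 ≤ t₁ ≤ ⋯ ≤ t_{m−j} ≤ j} t₁⋯t_{m−j}) · e^{jx} e^{r e^x}`,
the inner sum (the Stirling number of the second kind `S(m,j)`) being encoded as a
sum over monotone functions `Fin (m−j) → Fin (j+1)`. -/
theorem iteratedDeriv_exp_exp (r : ℝ) (x : ℝ) (m : ℕ) :
    iteratedDeriv m (fun t : ℝ => Real.exp (r * Real.exp t)) x =
      ∑ j ∈ Finset.range (m + 1),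
        r ^ j *
          (∑ g ∈ Finset.univ.filter
              (fun g : Fin (m - j) → Fin (j + 1) => ∀ i i', i ≤ i' → g i ≤ g i'),
            ∏ i, ((g i : ℕ) : ℝ)) *
          Real.exp ((j : ℝ) * x) * Real.exp (r * Real.exp x) := by
  rw [iteratedDeriv_exp_exp_stirlingSecond]
  refine Finset.sum_congr rfl fun j hj => ?_
  have hjm : j + (m - j) = m := Nat.add_sub_of_le (Nat.lt_succ_iff.1 (Finset.mem_range.1 hj))
  have h := monotoneProdSum_eq_stirlingSecond (m - j) j
  rw [hjm] at h
  rw [← h, monotoneProdSum]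
end

section
/- Let N ≥ 0, let r be a real number, let m ≥ 0, and let x be a real number with log^[N](x) > 0, where log^[N] denotes the N-fold iterate of the real logarithm. Then the m-th derivative at x of the function t ↦ (log^[N] t)^r (real power) equals Σ j_N! · C(r, j_N) · (−1)^{m − j_N} · (∏_{i=0}^{N−1} c(α_i, α_{i+1})) · (log^[N] x)^{r − j_N} · ∏_{i=0}^{N−1} (log^[i] x)^{−α_i}, where the outer sum is over all (N+1)-tuples (j_0, j_1, …, j_N) of natural numbers with j_0 + j_1 + ⋯ + j_N = m, and where α_i = j_i + j_{i+1} + ⋯ + j_N. -/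
/-- The signless Stirling number of the first kind `c(m,n)`, given by the sum over
strictly increasing `(m−n)`-tuples `0 ≤ t₁ < ⋯ < t_{m−n} < m` of the products
`t₁⋯t_{m−n}` (encoded as subsets of `{0,…,m−1}` of size `m−n`), with `c(m,n) = 0`
when `n > m`. -/
def stirlingFirst (m n : ℕ) : ℕ :=
  if n ≤ m then ∑ T ∈ (Finset.range m).powersetCard (m - n), ∏ t ∈ T, t else 0

theorem stirlingFirst_eq_zero_of_lt {m n : ℕ} (h : m < n) : stirlingFirst m n = 0 := by
  simp [stirlingFirst, h.not_ge]

theorem stirlingFirst_succ_zero (m : ℕ) : stirlingFirst (m + 1) 0 = m * stirlingFirst m 0 := by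
  have h (k : ℕ) : stirlingFirst k 0 = ∏ t ∈ Finset.range k, t := by
    have hself : (Finset.range k).powersetCard k = {Finset.range k} := by
      simpa using Finset.powersetCard_self (Finset.range k)
    simp [stirlingFirst, hself]
  rw [h, h, Finset.prod_range_succ, mul_comm]

theorem stirlingFirst_succ_succ (m n : ℕ) :
    stirlingFirst (m + 1) (n + 1) = stirlingFirst m n + m * stirlingFirst m (n + 1) := by
  rcases lt_trichotomy n m with h | rfl | h
  · obtain ⟨d, rfl⟩ := Nat.exists_eq_add_of_lt h
    have hmem : n + d + 1 ∉ Finset.range (n + d + 1) := by simp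
    rw [stirlingFirst, stirlingFirst, stirlingFirst, if_pos (by omega), if_pos (by omega),
      if_pos (by omega), show n + d + 1 + 1 - (n + 1) = d + 1 by omega,
      show n + d + 1 - n = d + 1 by omega, show n + d + 1 - (n + 1) = d by omega,
      Finset.range_add_one (n := n + d + 1), Finset.powersetCard_succ_insert hmem,
      Finset.sum_union, Finset.sum_image, Finset.mul_sum]
    · congr 1
      refine Finset.sum_congr rfl fun T hT => Finset.prod_insert fun h => ?_
      exact hmem ((Finset.mem_powersetCard.mp hT).1 h)
    · intro S hS T hT hST
      have hS' : n + d + 1 ∉ S := fun h => hmem ((Finset.mem_powersetCard.mp hS).1 h)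
      have hT' : n + d + 1 ∉ T := fun h => hmem ((Finset.mem_powersetCard.mp hT).1 h)
      rw [← Finset.erase_insert hS', ← Finset.erase_insert hT', hST]
    · refine Finset.disjoint_left.mpr fun S hS hS' => ?_
      obtain ⟨T, -, rfl⟩ := Finset.mem_image.mp hS'
      exact hmem ((Finset.mem_powersetCard.mp hS).1 (Finset.mem_insert_self _ _))
  · simp [stirlingFirst]
  · simp [stirlingFirst_eq_zero_of_lt, h, h.trans (Nat.lt_succ_self n)]

/-- The sum of signed Stirling numbers of the first kind against a sequence satisfies the
recurrence of the iterated derivatives of a composition with the logarithm. -/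
theorem sum_range_signed_stirlingFirst_succ {R : Type*} [CommRing R] (m : ℕ) (g : ℕ → R) :
    ∑ k ∈ Finset.range (m + 2), (-1) ^ (m + 1 - k) * (stirlingFirst (m + 1) k : R) * g k =
      ∑ k ∈ Finset.range (m + 1),
        (-1) ^ (m - k) * (stirlingFirst m k : R) * (g (k + 1) - m * g k) := by
  have hstep : ∀ k ∈ Finset.range (m + 1),
      (-1) ^ (m + 1 - (k + 1)) * (stirlingFirst (m + 1) (k + 1) : R) * g (k + 1) =
        (-1) ^ (m - k) * (stirlingFirst m k : R) * g (k + 1) -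
          m * ((-1) ^ (m - (k + 1)) * (stirlingFirst m (k + 1) : R) * g (k + 1)) := by
    intro k _
    rw [stirlingFirst_succ_succ, Nat.add_sub_add_right]
    rcases le_or_gt m k with h | h
    · simp [stirlingFirst_eq_zero_of_lt (Nat.lt_succ_of_le h)]
    · obtain ⟨d, rfl⟩ := Nat.exists_eq_add_of_lt h
      rw [show k + d + 1 - k = d + 1 by omega, show k + d + 1 - (k + 1) = d by omega]
      push_cast
      ring
  have hshift := Finset.sum_range_succ'
    (fun k => (-1) ^ (m - k) * (stirlingFirst m k : R) * g k) (m + 1)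
  rw [Finset.sum_range_succ, stirlingFirst_eq_zero_of_lt (Nat.lt_succ_self m)] at hshift
  rw [Finset.sum_range_succ', Finset.sum_congr rfl hstep, Finset.sum_sub_distrib,
    ← Finset.mul_sum, stirlingFirst_succ_zero]
  simp only [mul_sub, Finset.sum_sub_distrib]
  have hcomm : ∑ k ∈ Finset.range (m + 1), (-1) ^ (m - k) * (stirlingFirst m k : R) * (m * g k) =
      m * ∑ k ∈ Finset.range (m + 1), (-1) ^ (m - k) * (stirlingFirst m k : R) * g k := by
    rw [Finset.mul_sum]
    exact Finset.sum_congr rfl fun k _ => by ring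
  simp only [Nat.cast_zero, mul_zero, zero_mul, add_zero, Nat.sub_zero] at hshift
  rw [hcomm, hshift]
  push_cast
  ring

theorem ContDiffAt.differentiableAt_iteratedDeriv {𝕜 F : Type*} [NontriviallyNormedField 𝕜]
    [NormedAddCommGroup F] [NormedSpace 𝕜 F] {f : 𝕜 → F} {x : 𝕜} {n : WithTop ℕ∞} {m : ℕ}
    (h : ContDiffAt 𝕜 n f x) (hmn : m < n) : DifferentiableAt 𝕜 (iteratedDeriv m f) x := by
  simp only [← differentiableWithinAt_univ, ← iteratedDerivWithin_univ]
  exact h.contDiffWithinAt.differentiableWithinAt_iteratedDerivWithin hmn (by simp)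

open Filter Topology in
theorem iteratedDeriv_comp_log {f : ℝ → ℝ} {m : ℕ} {x : ℝ} (hx : x ≠ 0)
    (hf : ContDiffAt ℝ m f (Real.log x)) :
    iteratedDeriv m (fun t => f (Real.log t)) x =
      (x ^ m)⁻¹ * ∑ k ∈ Finset.range (m + 1),
        (-1) ^ (m - k) * (stirlingFirst m k : ℝ) * iteratedDeriv k f (Real.log x) := by
  induction m generalizing x with
  | zero => simp [stirlingFirst]
  | succ m ih =>
    have hev : iteratedDeriv m (fun t => f (Real.log t)) =ᶠ[𝓝 x] fun t =>
        (t ^ m)⁻¹ * ∑ k ∈ Finset.range (m + 1),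
          (-1) ^ (m - k) * (stirlingFirst m k : ℝ) * iteratedDeriv k f (Real.log t) := by
      filter_upwards [eventually_ne_nhds hx, (Real.continuousAt_log hx).eventually
        (hf.eventually (ENat.natCast_ne_coe_top _))] with t ht hft
      exact ih ht (hft.of_le (by exact_mod_cast m.le_succ))
    have hderiv : ∀ k ∈ Finset.range (m + 1), HasDerivAt
        (fun t => (-1) ^ (m - k) * (stirlingFirst m k : ℝ) * iteratedDeriv k f (Real.log t))
        ((-1) ^ (m - k) * (stirlingFirst m k : ℝ) *
          (iteratedDeriv (k + 1) f (Real.log x) * x⁻¹)) x := by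
      intro k hk
      have hk' : DifferentiableAt ℝ (iteratedDeriv k f) (Real.log x) :=
        hf.differentiableAt_iteratedDeriv (by exact_mod_cast Finset.mem_range.mp hk)
      rw [iteratedDeriv_succ]
      exact (hk'.hasDerivAt.comp x (Real.hasDerivAt_log hx)).const_mul _
    have hprod := ((hasDerivAt_pow m x).fun_inv (pow_ne_zero m hx)).mul
      (HasDerivAt.fun_sum hderiv)
    rw [iteratedDeriv_succ, hev.deriv_eq, sum_range_signed_stirlingFirst_succ]
    refine hprod.deriv.trans ?_
    rw [Finset.mul_sum, Finset.mul_sum, Finset.mul_sum, ← Finset.sum_add_distrib]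
    refine Finset.sum_congr rfl fun k _ => ?_
    rcases m with _ | m
    · simp
      ring
    · simp only [Nat.add_sub_cancel]
      field_simp
      ring

theorem Real.contDiffAt_iterate_log {N : ℕ} {n : WithTop ℕ∞} {x : ℝ}
    (hx : Real.log^[N] x ≠ 0) : ContDiffAt ℝ n (Real.log^[N]) x := by
  induction N generalizing x with
  | zero => exact contDiffAt_id
  | succ N ih =>
    have hx0 : x ≠ 0 := by
      rintro rfl
      exact hx (Function.iterate_fixed Real.log_zero _)
    exact (ih hx).comp x (Real.contDiffAt_log.mpr hx0)

theorem Finset.Nat.sum_antidiagonalTuple_succ {M : Type*} [AddCommMonoid M] (n m : ℕ)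
    (F : (Fin (n + 1) → ℕ) → M) :
    ∑ j ∈ antidiagonalTuple (n + 1) m, F j =
      ∑ k ∈ range (m + 1), ∑ j ∈ antidiagonalTuple n k,
        F (Fin.cons (m - k) j : Fin (n + 1) → ℕ) := by
  rw [Finset.sum_sigma']
  refine Finset.sum_bij' (fun j _ => ⟨∑ i, Fin.tail j i, Fin.tail j⟩)
    (fun p _ => Fin.cons (m - p.1) p.2) ?_ ?_ ?_ ?_ ?_
  · intro j hj
    rw [mem_antidiagonalTuple, Fin.sum_univ_succ] at hj
    simp only [mem_sigma, mem_range, mem_antidiagonalTuple, and_true, Fin.tail]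
    omega
  · rintro ⟨k, j⟩ hp
    simp only [mem_sigma, mem_range, mem_antidiagonalTuple] at hp
    simp only [mem_antidiagonalTuple, Fin.sum_univ_succ, Fin.cons_zero, Fin.cons_succ]
    omega
  · intro j hj
    rw [mem_antidiagonalTuple, Fin.sum_univ_succ] at hj
    have h0 : m - ∑ i, Fin.tail j i = j 0 := by
      simp only [Fin.tail]
      omega
    simp only [h0, Fin.cons_self_tail]
  · rintro ⟨k, j⟩ hp
    simp only [mem_sigma, mem_range, mem_antidiagonalTuple] at hp
    obtain ⟨-, rfl⟩ := hp
    simp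
  · intro j hj
    rw [mem_antidiagonalTuple, Fin.sum_univ_succ] at hj
    have h0 : m - ∑ i, Fin.tail j i = j 0 := by
      simp only [Fin.tail]
      omega
    simp only [h0, Fin.cons_self_tail]

theorem Fin.sum_filter_succ_le_cons {n : ℕ} (a i : ℕ) (j : Fin n → ℕ) :
    ∑ k ∈ Finset.univ.filter (fun k : Fin (n + 1) => i + 1 ≤ (k : ℕ)),
        (Fin.cons a j : Fin (n + 1) → ℕ) k =
      ∑ k ∈ Finset.univ.filter (fun k : Fin n => i ≤ (k : ℕ)), j k := by
  simp [Finset.sum_filter, Fin.sum_univ_succ]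

/-- Expansion of the iterated logarithm, first method: for `log^[N] x > 0`,
`(d/dx)^m (log^[N] x)^r = Σ_{j₀+⋯+j_N = m} j_N! C(r,j_N) (−1)^{m−j_N}
(∏_{i=0}^{N−1} c(α_i, α_{i+1})) (log^[N] x)^{r−j_N} ∏_{i=0}^{N−1} (log^[i] x)^{−α_i}`,
where `α_i = j_i + ⋯ + j_N` (so `α_N = j_N`). -/
theorem iteratedDeriv_iteratedLog_rpow (N : ℕ) (r : ℝ) (m : ℕ) (x : ℝ)
    (hx : 0 < Real.log^[N] x) :
    iteratedDeriv m (fun t : ℝ => (Real.log^[N] t) ^ r) x =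
      ∑ j ∈ Finset.Nat.antidiagonalTuple (N + 1) m,
        (fun α : ℕ → ℕ =>
            ((α N).factorial : ℝ) *
              ((∏ i ∈ Finset.range (α N), (r - i)) / (α N).factorial) *
              (-1) ^ (m - α N) *
              (∏ i ∈ Finset.range N, (stirlingFirst (α i) (α (i + 1)) : ℝ)) *
              (Real.log^[N] x) ^ (r - α N) *
              ∏ i ∈ Finset.range N, (Real.log^[i] x) ^ (-(α i : ℝ)))
          (fun i => ∑ k ∈ Finset.univ.filter (fun k : Fin (N + 1) => i ≤ (k : ℕ)), j k) := by
  induction N generalizing m x with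
  | zero =>
    have hm : (Finset.univ.filter fun k : Fin 1 => 0 ≤ (k : ℕ)) = {0} := by decide
    simp only [Function.iterate_zero, id_eq] at hx ⊢
    rw [iteratedDeriv_eq_iterate, Real.iter_deriv_rpow_const,
      descPochhammer_eval_eq_prod_range]
    simp only [Nat.reduceAdd, Finset.Nat.antidiagonalTuple_one, Finset.sum_singleton, hm]
    simp only [Matrix.cons_val_zero, Nat.sub_self, pow_zero, Finset.range_zero,
      Finset.prod_empty, mul_one]
    field_simp
  | succ N ih =>
    have hx0 : x ≠ 0 := by
      rintro rfl
      exact hx.ne' (Function.iterate_fixed Real.log_zero _)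
    have hlog : 0 < Real.log^[N] (Real.log x) := hx
    have hf : ContDiffAt ℝ m (fun t : ℝ => (Real.log^[N] t) ^ r) (Real.log x) :=
      (Real.contDiffAt_iterate_log hlog.ne').rpow_const_of_ne hlog.ne'
    have hcomp := iteratedDeriv_comp_log hx0 hf
    simp only [Function.iterate_succ_apply]
    rw [hcomp, Finset.Nat.sum_antidiagonalTuple_succ, Finset.mul_sum]
    refine Finset.sum_congr rfl fun k hk => ?_
    rw [ih k _ hlog, Finset.mul_sum, Finset.mul_sum]
    refine Finset.sum_congr rfl fun j hj => ?_
    rw [Finset.Nat.mem_antidiagonalTuple] at hj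
    have hk' : k ≤ m := Nat.lt_succ_iff.mp (Finset.mem_range.mp hk)
    have htail : ∑ l ∈ Finset.univ.filter (fun l : Fin (N + 1) => N ≤ (l : ℕ)), j l ≤ k :=
      hj ▸ Finset.sum_le_univ_sum_of_nonneg fun _ => Nat.zero_le _
    have htotal : ∑ l ∈ Finset.univ.filter (fun l : Fin (N + 1 + 1) => 0 ≤ (l : ℕ)),
        (Fin.cons (m - k) j : Fin (N + 1 + 1) → ℕ) l = m := by
      simp [Fin.sum_univ_succ, hj, hk']
    have htotal' : ∑ l ∈ Finset.univ.filter (fun l : Fin (N + 1) => 0 ≤ (l : ℕ)), j l = k := by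
      simpa using hj
    simp only [Finset.prod_range_succ', Fin.sum_filter_succ_le_cons, htotal, htotal',
      Function.iterate_succ_apply, Function.iterate_zero, id_eq, Real.rpow_neg_natCast, zpow_neg,
      zpow_natCast]
    generalize ∑ l ∈ Finset.univ.filter (fun l : Fin (N + 1) => N ≤ (l : ℕ)), j l = a at *
    rw [show m - a = (m - k) + (k - a) by omega, pow_add]
    ring
end

section
/- Let s : ℕ → ℕ → ℝ be any function satisfying s(m,n) = (m−1)·s(m−1,n) + s(m−1,n−1) for all 1 ≤ n < m, together with s(m,0) = 0 for all m > 0 and s(m,m) = 1 for all m ≥ 0. Then for every real r, every real x > 1, and every m ≥ 0, the m-th derivative at x of the function t ↦ (log t)^r (real power) equals Σ_{n=0}^{m} C(r,n) · n! · (−1)^{m−n} · s(m,n) · x^{−m} · (log x)^{r−n}, where C(r,n) = (∏_{i=0}^{n−1}(r−i))/n! is the generalized binomial coefficient. -/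
/-- The derivative of `t ↦ c t^{-m} (log t)^a` at a point `x > 1`. -/
theorem hasDerivAt_const_mul_rpow_mul_log_rpow (c a : ℝ) (m : ℕ) {x : ℝ} (hx : 1 < x) :
    HasDerivAt (fun t : ℝ => c * t ^ (-(m : ℝ)) * Real.log t ^ a)
      (x ^ (-((m + 1 : ℕ) : ℝ)) *
        (-(m * c * Real.log x ^ a) + c * a * Real.log x ^ (a - 1))) x := by
  have hx0 : 0 < x := by linarith
  have h1 := Real.hasDerivAt_rpow_const (x := x) (p := -(m : ℝ)) (Or.inl hx0.ne')
  have h2 := (Real.hasDerivAt_log hx0.ne').rpow_const (p := a) (Or.inl (Real.log_pos hx).ne')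
  have hpow : x ^ (-(m : ℝ)) * x⁻¹ = x ^ (-((m + 1 : ℕ) : ℝ)) := by
    rw [← Real.rpow_neg_one x, ← Real.rpow_add hx0]
    congr 1
    push_cast
    ring
  have hpow' : x ^ (-(m : ℝ) - 1) = x ^ (-((m + 1 : ℕ) : ℝ)) := by
    congr 1
    push_cast
    ring
  refine ((h1.const_mul c).mul h2).congr_deriv ?_
  rw [hpow', ← hpow]
  ring

open Finset in
/-- The step from `m` to `m + 1` for the coefficients of the expansion, with falling factorials
`∏ i ∈ range n, (r - i)` and arbitrary weights `L`. -/
theorem sum_fallingFactorial_mul_recurrence (s : ℕ → ℕ → ℝ)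
    (hrec : ∀ m n : ℕ, 1 ≤ n → n < m →
      s m n = ((m : ℝ) - 1) * s (m - 1) n + s (m - 1) (n - 1))
    (hzero : ∀ m : ℕ, 0 < m → s m 0 = 0)
    (hdiag : ∀ m : ℕ, s m m = 1)
    (r : ℝ) (L : ℕ → ℝ) (m : ℕ) :
    ∑ n ∈ range (m + 1),
        (-(m * ((∏ i ∈ range n, (r - i)) * (-1) ^ (m - n) * s m n) * L n) +
          (∏ i ∈ range n, (r - i)) * (-1) ^ (m - n) * s m n * (r - n) * L (n + 1)) =
      ∑ n ∈ range (m + 2),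
        (∏ i ∈ range n, (r - i)) * (-1) ^ (m + 1 - n) * s (m + 1) n * L n := by
  have hm : (m : ℝ) * s m 0 = 0 := by
    rcases m.eq_zero_or_pos with rfl | h
    · simp
    · simp [hzero m h]
  rw [sum_add_distrib, sum_range_succ' _ m, sum_range_succ _ m, sum_range_succ' _ (m + 1),
    sum_range_succ _ m, hzero (m + 1) m.succ_pos, hdiag, hdiag, prod_range_succ _ m]
  have hfirst : -(m * ((∏ i ∈ range 0, (r - (i : ℝ))) * (-1) ^ (m - 0) * s m 0) * L 0) = 0 := by
    linear_combination (-(∏ i ∈ range 0, (r - (i : ℝ))) * (-1) ^ (m - 0) * L 0) * hm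
  rw [hfirst]
  have hmid : ∀ k ∈ range m,
      (∏ i ∈ range (k + 1), (r - (i : ℝ))) * (-1) ^ (m + 1 - (k + 1)) * s (m + 1) (k + 1) *
          L (k + 1) =
        -(m * ((∏ i ∈ range (k + 1), (r - (i : ℝ))) * (-1) ^ (m - (k + 1)) * s m (k + 1)) *
            L (k + 1)) +
          (∏ i ∈ range k, (r - (i : ℝ))) * (-1) ^ (m - k) * s m k * (r - k) * L (k + 1) := by
    intro k hk
    have hk : k < m := mem_range.mp hk
    obtain ⟨d, rfl⟩ := Nat.exists_eq_add_of_lt hk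
    rw [hrec (k + d + 1 + 1) (k + 1) (by omega) (by omega), prod_range_succ,
      show k + d + 1 + 1 - (k + 1) = d + 1 by omega, show k + d + 1 - (k + 1) = d by omega,
      show k + d + 1 - k = d + 1 by omega]
    simp only [Nat.add_sub_cancel]
    push_cast
    ring
  rw [sum_congr rfl hmid, sum_add_distrib]
  simp only [Nat.sub_self]
  ring


/-- Any solution `s` of the discrete boundary value problem
`s(m,n) = (m−1)·s(m−1,n) + s(m−1,n−1)` (for `1 ≤ n < m`), `s(m,0) = 0` (for `m > 0`),
`s(m,m) = 1`, gives the expansion coefficients of `(log(x+y))^r`: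
`(d/dx)^m (log x)^r = Σ_{n=0}^{m} C(r,n) n! (−1)^{m−n} s(m,n) x^{−m} (log x)^{r−n}`. -/
theorem iteratedDeriv_log_rpow_of_recurrence (s : ℕ → ℕ → ℝ)
    (hrec : ∀ m n : ℕ, 1 ≤ n → n < m →
      s m n = ((m : ℝ) - 1) * s (m - 1) n + s (m - 1) (n - 1))
    (hzero : ∀ m : ℕ, 0 < m → s m 0 = 0)
    (hdiag : ∀ m : ℕ, s m m = 1)
    (r : ℝ) (x : ℝ) (hx : 1 < x) (m : ℕ) :
    iteratedDeriv m (fun t : ℝ => Real.log t ^ r) x =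
      ∑ n ∈ Finset.range (m + 1),
        ((∏ i ∈ Finset.range n, (r - i)) / n.factorial) * (n.factorial : ℝ) *
          (-1) ^ (m - n) * s m n * x ^ (-(m : ℝ)) * Real.log x ^ (r - n) := by
  have hfac : ∀ n : ℕ, (n.factorial : ℝ) ≠ 0 := fun n => by positivity
  simp only [div_mul_cancel₀ _ (hfac _)]
  induction m generalizing x with
  | zero => simp [hdiag]
  | succ m ih =>
    rw [iteratedDeriv_succ]
    have heq := Filter.eventuallyEq_of_mem (Ioi_mem_nhds hx) fun y hy => ih y hy
    rw [heq.deriv_eq]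
    have hder := HasDerivAt.fun_sum (u := Finset.range (m + 1)) fun n _ =>
      hasDerivAt_const_mul_rpow_mul_log_rpow
        ((∏ i ∈ Finset.range n, (r - i)) * (-1) ^ (m - n) * s m n) (r - n) m hx
    rw [hder.deriv, ← Finset.mul_sum]
    have hstep := sum_fallingFactorial_mul_recurrence s hrec hzero hdiag r
      (fun n => Real.log x ^ (r - n)) m
    simp only [Nat.cast_add, Nat.cast_one, ← sub_sub] at hstep ⊢
    rw [hstep, Finset.mul_sum]
    exact Finset.sum_congr rfl fun n _ => by ring
end

section
/- Let S : ℕ → ℕ → ℝ be any function satisfying S(m,n) = n·S(m−1,n) + S(m−1,n−1) for all 1 ≤ n < m, together with S(m,0) = 0 for all m > 0 and S(m,m) = 1 for all m ≥ 0. Then for every real r, every real x, and every m ≥ 0, the m-th derivative at x of the function t ↦ exp(r · exp t) equals Σ_{n=0}^{m} r^n · S(m,n) · exp(n·x) · exp(r · exp x). -/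
/-- Any solution `S` of the discrete boundary value problem
`S(m,n) = n·S(m−1,n) + S(m−1,n−1)` (for `1 ≤ n < m`), `S(m,0) = 0` (for `m > 0`),
`S(m,m) = 1`, gives the expansion coefficients of `(e^{e^{x+y}})^r`:
`(d/dx)^m e^{r e^x} = Σ_{n=0}^{m} r^n S(m,n) e^{nx} e^{r e^x}`. -/
theorem iteratedDeriv_exp_exp_of_recurrence (S : ℕ → ℕ → ℝ)
    (hrec : ∀ m n : ℕ, 1 ≤ n → n < m →
      S m n = (n : ℝ) * S (m - 1) n + S (m - 1) (n - 1))
    (hzero : ∀ m : ℕ, 0 < m → S m 0 = 0)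
    (hdiag : ∀ m : ℕ, S m m = 1)
    (r : ℝ) (x : ℝ) (m : ℕ) :
    iteratedDeriv m (fun t : ℝ => Real.exp (r * Real.exp t)) x =
      ∑ n ∈ Finset.range (m + 1),
        r ^ n * S m n * Real.exp ((n : ℝ) * x) * Real.exp (r * Real.exp x) := by
  induction m generalizing x with
  | zero => simp [hdiag]
  | succ m ih =>
    have hterm (n : ℕ) : HasDerivAt
        (fun t : ℝ => r ^ n * S m n * Real.exp ((n : ℝ) * t) * Real.exp (r * Real.exp t))
        ((n : ℝ) * (r ^ n * S m n * Real.exp ((n : ℝ) * x) * Real.exp (r * Real.exp x)) +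
          r ^ (n + 1) * S m n * Real.exp (((n + 1 : ℕ) : ℝ) * x) * Real.exp (r * Real.exp x))
        x := by
      have hexp : HasDerivAt (fun t : ℝ => Real.exp ((n : ℝ) * t))
          (Real.exp ((n : ℝ) * x) * ((n : ℝ) * 1)) x :=
        ((hasDerivAt_id x).const_mul (n : ℝ)).exp
      have hexpexp : HasDerivAt (fun t : ℝ => Real.exp (r * Real.exp t))
          (Real.exp (r * Real.exp x) * (r * Real.exp x)) x :=
        ((Real.hasDerivAt_exp x).const_mul r).exp
      refine ((hexp.const_mul (r ^ n * S m n)).mul hexpexp).congr_deriv ?_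
      push_cast
      rw [add_mul, one_mul, Real.exp_add]
      ring
    rw [iteratedDeriv_succ, funext ih,
      (HasDerivAt.fun_sum fun n (_ : n ∈ Finset.range (m + 1)) => hterm n).deriv,
      Finset.sum_add_distrib, Finset.sum_range_succ', Finset.sum_range_succ _ m,
      Finset.sum_range_succ' _ (m + 1), Finset.sum_range_succ _ m, hzero (m + 1) m.succ_pos,
      hdiag, hdiag, Nat.cast_zero, zero_mul, add_zero, mul_zero, zero_mul, zero_mul, add_zero,
      ← add_assoc, ← Finset.sum_add_distrib]
    congr 1
    refine Finset.sum_congr rfl fun n hn => ?_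
    rw [hrec (m + 1) (n + 1) (by omega) (by have := Finset.mem_range.mp hn; omega)]
    simp only [Nat.add_sub_cancel]
    ring
end

section
/- Fix a real number s, and let N : ℕ → ℕ → ℝ be any function satisfying N(m,j) = (s+j)·N(m−1,j) + N(m−1,j−1) for all 1 ≤ j < m, together with N(m,0) = s^m for all m > 0 and N(m,m) = 1 for all m ≥ 0. Then for every real r, every real x, and every m ≥ 0, the m-th derivative at x of the function t ↦ exp(s·t) · exp(r · exp t) equals Σ_{j=0}^{m} r^j · N(m,j) · exp((s+j)·x) · exp(r · exp x). -/
/-- The coefficient recurrence, as a summation by parts: if `f j` has derivative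
`(s + j) * f j + f (j + 1)`, then `∑ N m j * f j` has derivative `∑ N (m + 1) j * f j`. -/
theorem sum_recurrence_mul_eq (s : ℝ) (N : ℕ → ℕ → ℝ)
    (hrec : ∀ m j : ℕ, 1 ≤ j → j < m →
      N m j = (s + j) * N (m - 1) j + N (m - 1) (j - 1))
    (hzero : ∀ m : ℕ, 0 < m → N m 0 = s ^ m)
    (hdiag : ∀ m : ℕ, N m m = 1) (f : ℕ → ℝ) (m : ℕ) :
    ∑ j ∈ Finset.range (m + 1), N m j * ((s + j) * f j + f (j + 1)) =
      ∑ j ∈ Finset.range (m + 2), N (m + 1) j * f j := by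
  have hm0 : N m 0 = s ^ m := by
    rcases m.eq_zero_or_pos with rfl | hm
    · simp [hdiag]
    · exact hzero m hm
  have hinner : ∑ j ∈ Finset.range m, N (m + 1) (j + 1) * f (j + 1) =
      ∑ j ∈ Finset.range m, N m (j + 1) * ((s + (j + 1 : ℕ)) * f (j + 1)) +
        ∑ j ∈ Finset.range m, N m j * f (j + 1) := by
    rw [← Finset.sum_add_distrib]
    refine Finset.sum_congr rfl fun j hj => ?_
    have hj' := Finset.mem_range.mp hj
    rw [hrec (m + 1) (j + 1) (by omega) (by omega)]
    simp only [Nat.add_sub_cancel]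
    ring
  simp only [mul_add (N m _)]
  rw [Finset.sum_add_distrib, Finset.sum_range_succ',
    Finset.sum_range_succ (fun j => N m j * f (j + 1)),
    Finset.sum_range_succ', Finset.sum_range_succ (fun j => N (m + 1) (j + 1) * f (j + 1)),
    hinner, hdiag, hdiag, hm0, hzero (m + 1) m.succ_pos]
  push_cast
  ring

theorem hasDerivAt_pow_mul_exp_mul_exp_exp (s r x : ℝ) (j : ℕ) :
    HasDerivAt (fun t : ℝ => r ^ j * Real.exp ((s + j) * t) * Real.exp (r * Real.exp t))
      ((s + j) * (r ^ j * Real.exp ((s + j) * x) * Real.exp (r * Real.exp x)) +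
        r ^ (j + 1) * Real.exp ((s + (j + 1 : ℕ)) * x) * Real.exp (r * Real.exp x)) x := by
  have hlin := (((hasDerivAt_id x).const_mul (s + j)).exp).const_mul (r ^ j)
  have hexp := ((Real.hasDerivAt_exp x).const_mul r).exp
  have hsplit : Real.exp ((s + (j + 1 : ℕ)) * x) = Real.exp ((s + j) * x) * Real.exp x := by
    rw [← Real.exp_add]
    push_cast
    ring_nf
  refine (hlin.mul hexp).congr_deriv ?_
  rw [hsplit]
  simp only [id_eq]
  ring

/-- Fix `s : ℝ`. Any solution `N` of the recurrence
`N(m,j) = (s+j)·N(m−1,j) + N(m−1,j−1)` (for `1 ≤ j < m`), with `N(m,0) = s^m` for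
`m > 0` and `N(m,m) = 1`, gives the expansion coefficients of
`e^{s(x+y)} (e^{e^{x+y}})^r`:
`(d/dx)^m (e^{sx} e^{r e^x}) = Σ_{j=0}^{m} r^j N(m,j) e^{(s+j)x} e^{r e^x}`. -/
theorem iteratedDeriv_exp_mul_exp_exp_of_recurrence (s : ℝ) (N : ℕ → ℕ → ℝ)
    (hrec : ∀ m j : ℕ, 1 ≤ j → j < m →
      N m j = (s + j) * N (m - 1) j + N (m - 1) (j - 1))
    (hzero : ∀ m : ℕ, 0 < m → N m 0 = s ^ m)
    (hdiag : ∀ m : ℕ, N m m = 1)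
    (r : ℝ) (x : ℝ) (m : ℕ) :
    iteratedDeriv m (fun t : ℝ => Real.exp (s * t) * Real.exp (r * Real.exp t)) x =
      ∑ j ∈ Finset.range (m + 1),
        r ^ j * N m j * Real.exp ((s + j) * x) * Real.exp (r * Real.exp x) := by
  induction m generalizing x with
  | zero => simp [hdiag]
  | succ m ih =>
    rw [iteratedDeriv_succ, funext ih]
    have hderiv := HasDerivAt.fun_sum (u := Finset.range (m + 1)) fun j _ =>
      (hasDerivAt_pow_mul_exp_mul_exp_exp s r x j).const_mul (N m j)
    rw [sum_recurrence_mul_eq s N hrec hzero hdiag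
      (fun j => r ^ j * Real.exp ((s + j) * x) * Real.exp (r * Real.exp x))] at hderiv
    convert hderiv.deriv using 2
    · funext t
      exact Finset.sum_congr rfl fun j _ => by ring
    · ring
end
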